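/- For every m × n stencil H and every natural number k ≥ 2, the visible rank of the k-th tensor power satisfies vrk(H^{⊗k}) ≤ 2·k² · vrk(H^{⊗(k−1)}) · drk(H^{⊗k}), where drk denotes the distinct rank. -/

import Mathlib

noncomputable section

/-- A square stencil (Bool matrix, `true` = ⋆) is visibly full rank if it has a
unique generalized diagonal of ⋆'s. -/
def VisFullRank {α : Type*} (M : Matrix α α Bool) : Prop :=
  ∃! σ : Equiv.Perm α, ∀ i, M i (σ i) = true

/-- The visible rank of a stencil: the largest `k` admitting a `k × k`
visibly full rank sub-stencil. -/
def vrk {α β : Type*} (H : Matrix α β Bool) : ℕ :=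
  sSup {k : ℕ | ∃ r : Fin k → α, ∃ c : Fin k → β,
    Function.Injective r ∧ Function.Injective c ∧
    VisFullRank (Matrix.of fun i j => H (r i) (c j))}

/-- Tensor product of stencils. -/
def stTensor {α₁ β₁ α₂ β₂ : Type*} (H₁ : Matrix α₁ β₁ Bool) (H₂ : Matrix α₂ β₂ Bool) :
    Matrix (α₁ × α₂) (β₁ × β₂) Bool :=
  Matrix.of fun a b => H₁ a.1 b.1 && H₂ a.2 b.2

/-- `k`-th tensor power of a stencil. -/
def stPow {α β : Type*} (H : Matrix α β Bool) (k : ℕ) :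
    Matrix (Fin k → α) (Fin k → β) Bool :=
  Matrix.of fun r c => decide (∀ i, H (r i) (c i) = true)

/-- `W` is an `F`-witness of the stencil `H`. -/
def IsWitness {α β F : Type*} [Field F] (H : Matrix α β Bool) (W : Matrix α β F) : Prop :=
  ∀ i j, W i j ≠ 0 ↔ H i j = true

/-- The `F`-rank of a stencil: the minimum rank of an `F`-witness. -/
def frk (F : Type*) [Field F] {α β : Type*} [Fintype β] (H : Matrix α β Bool) : ℕ :=
  sInf {r : ℕ | ∃ W : Matrix α β F, IsWitness H W ∧ W.rank = r}

/-- The distinct rank of `H^{⊗k}`: the largest `ℓ` for which `H^{⊗k}` has an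
`ℓ × ℓ` visibly full rank sub-stencil whose rows have pairwise disjoint sets of
coordinate values, and likewise for columns. -/
def drk {m n : ℕ} (H : Matrix (Fin m) (Fin n) Bool) (k : ℕ) : ℕ :=
  sSup {ℓ : ℕ | ∃ (r : Fin ℓ → (Fin k → Fin m)) (c : Fin ℓ → (Fin k → Fin n)),
    Function.Injective r ∧ Function.Injective c ∧
    (∀ i j, i ≠ j → Set.range (r i) ∩ Set.range (r j) = ∅) ∧
    (∀ i j, i ≠ j → Set.range (c i) ∩ Set.range (c j) = ∅) ∧
    VisFullRank (Matrix.of fun i j => stPow H k (r i) (c j))}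

theorem VisFullRank.row_injective {α : Type*} {M : Matrix α α Bool} (h : VisFullRank M) :
    Function.Injective M := by
  classical
  obtain ⟨σ, hσ, huniq⟩ := h
  intro i j hij
  have key : σ * Equiv.swap i j = σ := by
    refine huniq _ fun x => ?_
    rw [Equiv.Perm.mul_apply]
    by_cases hi : x = i
    · subst hi; rw [Equiv.swap_apply_left, hij]; exact hσ j
    · by_cases hj : x = j
      · subst hj; rw [Equiv.swap_apply_right, ← hij]; exact hσ i
      · rw [Equiv.swap_apply_of_ne_of_ne hi hj]; exact hσ x
  exact Equiv.swap_eq_one_iff.mp (mul_eq_left.mp key)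

theorem VisFullRank.transpose {α : Type*} {M : Matrix α α Bool} (h : VisFullRank M) :
    VisFullRank M.transpose := by
  obtain ⟨σ, hσ, huniq⟩ := h
  refine ⟨σ⁻¹, fun i => by simpa using hσ (σ⁻¹ i), fun τ hτ => ?_⟩
  rw [← huniq τ⁻¹ fun i => by simpa using hτ (τ⁻¹ i), inv_inv]

theorem VisFullRank.reindex {α ι : Type*} {M : Matrix α α Bool} (h : VisFullRank M)
    (e : ι ≃ α) : VisFullRank (Matrix.of fun i j => M (e i) (e j)) := by
  obtain ⟨σ, hσ, huniq⟩ := h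
  refine ⟨e.symm.permCongr σ, fun i => by simpa using hσ (e i), fun τ hτ => ?_⟩
  rw [← huniq (e.permCongr τ) fun i => by simpa using hτ (e.symm i)]
  ext i
  simp

/-- A principal sub-stencil inherits visible full rank from a star diagonal. -/
theorem VisFullRank.principal {α : Type*} {M : Matrix α α Bool} (h : VisFullRank M)
    (hdiag : ∀ i, M i i = true) (s : Set α) :
    VisFullRank (Matrix.of fun i j : s => M i j) := by
  classical
  refine ⟨1, fun i => hdiag i, fun τ hτ => ?_⟩
  have key : Equiv.Perm.ofSubtype τ = 1 := by
    refine h.unique (fun i => ?_) hdiag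
    by_cases hi : i ∈ s
    · rw [Equiv.Perm.ofSubtype_apply_of_mem τ hi]; exact hτ ⟨i, hi⟩
    · rw [Equiv.Perm.ofSubtype_apply_of_not_mem τ hi]; exact hdiag i
  exact Equiv.Perm.ofSubtype_injective (by rw [key, map_one])

theorem card_le_vrk {α β ι : Type*} [Finite α] [Fintype ι] (H : Matrix α β Bool)
    (r : ι → α) (c : ι → β) (h : VisFullRank (Matrix.of fun i j => H (r i) (c j))) :
    Fintype.card ι ≤ vrk H := by
  have := Fintype.ofFinite α
  refine le_csSup ⟨Fintype.card α, ?_⟩ ?_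
  · rintro l ⟨r, -, hr, -⟩
    simpa using Fintype.card_le_of_injective r hr
  · have h' := h.reindex (Fintype.equivFin ι).symm
    refine ⟨fun i => r ((Fintype.equivFin ι).symm i), fun i => c ((Fintype.equivFin ι).symm i),
      fun i j hij => h'.row_injective ?_, fun i j hij => h'.transpose.row_injective ?_, h'⟩
    · ext x
      exact congrArg (fun a => H a _) hij
    · ext x
      exact congrArg (fun a => H _ a) hij

theorem exists_vrk_diagonal {α β : Type*} [Finite α] (H : Matrix α β Bool) :
    ∃ (r : Fin (vrk H) → α) (c : Fin (vrk H) → β),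
      VisFullRank (Matrix.of fun i j => H (r i) (c j)) ∧ ∀ i, H (r i) (c i) = true := by
  have := Fintype.ofFinite α
  have hmem : vrk H ∈ {k : ℕ | ∃ r : Fin k → α, ∃ c : Fin k → β,
      Function.Injective r ∧ Function.Injective c ∧
      VisFullRank (Matrix.of fun i j => H (r i) (c j))} := by
    refine Nat.sSup_mem ⟨0, Fin.elim0, Fin.elim0, fun i => i.elim0, fun i => i.elim0,
      1, fun i => i.elim0, fun _ _ => Subsingleton.elim _ _⟩ ⟨Fintype.card α, ?_⟩
    rintro l ⟨r, -, hr, -⟩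
    simpa using Fintype.card_le_of_injective r hr
  obtain ⟨r, c, -, -, σ, hσ, huniq⟩ := hmem
  refine ⟨r, c ∘ σ, ⟨1, hσ, fun τ hτ => ?_⟩, hσ⟩
  exact mul_eq_left.mp (huniq (σ * τ) hτ)

theorem card_le_drk {m n k : ℕ} {ι : Type*} [Fintype ι] (H : Matrix (Fin m) (Fin n) Bool)
    (r : ι → Fin k → Fin m) (c : ι → Fin k → Fin n)
    (hr : ∀ i j, i ≠ j → Set.range (r i) ∩ Set.range (r j) = ∅)
    (hc : ∀ i j, i ≠ j → Set.range (c i) ∩ Set.range (c j) = ∅)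
    (h : VisFullRank (Matrix.of fun i j => stPow H k (r i) (c j))) :
    Fintype.card ι ≤ drk H k := by
  refine le_csSup ⟨Fintype.card (Fin k → Fin m), ?_⟩ ?_
  · rintro l ⟨r, -, hr, -⟩
    simpa using Fintype.card_le_of_injective r hr
  · have h' := h.reindex (Fintype.equivFin ι).symm
    refine ⟨fun i => r ((Fintype.equivFin ι).symm i), fun i => c ((Fintype.equivFin ι).symm i),
      fun i j hij => h'.row_injective ?_, fun i j hij => h'.transpose.row_injective ?_,
      fun i j hij => hr _ _ (by simpa using hij), fun i j hij => hc _ _ (by simpa using hij), h'⟩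
    · ext x
      exact congrArg (fun a => stPow H k a _) hij
    · ext x
      exact congrArg (fun a => stPow H k _ a) hij

theorem stPow_eq_true_iff {α β : Type*} (H : Matrix α β Bool) (k : ℕ) (r : Fin k → α)
    (c : Fin k → β) : stPow H k r c = true ↔ ∀ i, H (r i) (c i) = true :=
  decide_eq_true_iff

/-- A tensor coordinate in which every entry is a star can be deleted. -/
theorem card_le_vrk_stPow_of_coordinate {α β ι : Type*} [Finite α] [Fintype ι]
    (H : Matrix α β Bool) {k : ℕ} (r : ι → Fin (k + 1) → α) (c : ι → Fin (k + 1) → β)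
    (h : VisFullRank (Matrix.of fun i j => stPow H (k + 1) (r i) (c j))) (t : Fin (k + 1))
    (ht : ∀ i j, H (r i t) (c j t) = true) : Fintype.card ι ≤ vrk (stPow H k) := by
  refine card_le_vrk _ (fun i => t.removeNth (r i)) (fun i => t.removeNth (c i)) ?_
  convert h using 3 with i
  ext j
  rw [Bool.eq_iff_iff, stPow_eq_true_iff, stPow_eq_true_iff]
  simp [Fin.forall_iff_succAbove t, ht, Fin.removeNth]

/-- `vrk(H^{⊗k}) ≤ 2k² · vrk(H^{⊗(k-1)}) · drk(H^{⊗k})`. -/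
theorem stmt18 (m n : ℕ) (H : Matrix (Fin m) (Fin n) Bool) (k : ℕ) (hk : 2 ≤ k) :
    vrk (stPow H k) ≤ 2 * k ^ 2 * vrk (stPow H (k - 1)) * drk H k := by
  obtain ⟨k, rfl⟩ : ∃ l, k = l + 1 := ⟨k - 1, by omega⟩
  rw [Nat.add_sub_cancel]
  obtain ⟨r, c, hfull, hdiag⟩ := exists_vrk_diagonal (stPow H (k + 1))
  have hstar : ∀ i t, H (r i t) (c i t) = true := fun i =>
    (stPow_eq_true_iff H _ _ _).mp (hdiag i)
  obtain ⟨I, hI⟩ := Set.Finite.exists_maximal (Set.toFinite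
    {I : Finset (Fin (vrk (stPow H (k + 1)))) | ∀ i ∈ I, ∀ j ∈ I, i ≠ j →
      Set.range (r i) ∩ Set.range (r j) = ∅ ∧ Set.range (c i) ∩ Set.range (c j) = ∅})
    ⟨∅, by simp⟩
  have hdisj := hI.prop
  have hIcard : I.card ≤ drk H (k + 1) := by
    rw [← Fintype.card_coe]
    exact card_le_drk H (fun i : I => r i) (fun i : I => c i)
      (fun i j hij => (hdisj i i.2 j j.2 (Subtype.coe_ne_coe.mpr hij)).1)
      (fun i j hij => (hdisj i i.2 j j.2 (Subtype.coe_ne_coe.mpr hij)).2)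
      (hfull.principal hdiag (I : Set _))
  have hcover : ∀ i, ∃ x : I × Fin (k + 1) × Fin (k + 1) × Bool,
      (x.2.2.2 = true ∧ r i x.2.1 = r x.1 x.2.2.1) ∨
        (x.2.2.2 = false ∧ c i x.2.1 = c x.1 x.2.2.1) := by
    intro i
    by_cases hi : i ∈ I
    · exact ⟨(⟨i, hi⟩, 0, 0, true), Or.inl ⟨rfl, rfl⟩⟩
    · by_contra! hne
      have hr : ∀ j ∈ I, ∀ t s, r i t ≠ r j s := fun j hj t s =>
        (hne (⟨j, hj⟩, t, s, true)).1 rfl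
      have hc : ∀ j ∈ I, ∀ t s, c i t ≠ c j s := fun j hj t s =>
        (hne (⟨j, hj⟩, t, s, false)).2 rfl
      have hle : insert i I ≤ I := by
        refine hI.le_of_ge ?_ (Finset.subset_insert i I)
        intro a ha b hb hab
        simp only [← Set.disjoint_iff_inter_eq_empty, Set.disjoint_range_iff]
        rcases Finset.mem_insert.mp ha with rfl | haI <;>
          rcases Finset.mem_insert.mp hb with rfl | hbI
        · exact absurd rfl hab
        · exact ⟨hr b hbI, hc b hbI⟩
        · exact ⟨fun t s => (hr a haI s t).symm, fun t s => (hc a haI s t).symm⟩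
        · simpa only [← Set.disjoint_iff_inter_eq_empty, Set.disjoint_range_iff]
            using hdisj a haI b hbI hab
      exact hi (hle (Finset.mem_insert_self i I))
  choose f hf using hcover
  have hfiber : ∀ x ∈ (Finset.univ : Finset (I × Fin (k + 1) × Fin (k + 1) × Bool)),
      (Finset.univ.filter fun i => f i = x).card ≤ vrk (stPow H k) := by
    intro x _
    rw [← Fintype.card_subtype]
    refine card_le_vrk_stPow_of_coordinate H (fun i : {i // f i = x} => r i) (fun i => c i)
      (hfull.principal hdiag {i | f i = x}) x.2.1 fun i j => ?_
    have hi := hf i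
    have hj := hf j
    rw [i.2] at hi
    rw [j.2] at hj
    rcases hi with ⟨hx, hi⟩ | ⟨hx, hi⟩ <;> rcases hj with ⟨hx', hj⟩ | ⟨hx', hj⟩
    · rw [hi, ← hj]; exact hstar j _
    · simp [hx] at hx'
    · simp [hx] at hx'
    · rw [hj, ← hi]; exact hstar i _
  have hcount := Finset.card_le_mul_card_image_of_maps_to
    (s := Finset.univ) (t := Finset.univ) (f := f) (fun _ _ => Finset.mem_univ _) _ hfiber
  simp only [Finset.card_univ, Fintype.card_fin, Fintype.card_prod, Fintype.card_coe,
    Fintype.card_bool] at hcount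
  calc vrk (stPow H (k + 1))
      ≤ vrk (stPow H k) * (I.card * ((k + 1) * ((k + 1) * 2))) := hcount
    _ = 2 * (k + 1) ^ 2 * vrk (stPow H k) * I.card := by ring
    _ ≤ _ := Nat.mul_le_mul_left _ hIcard
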